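/- Fix a real α with 0 ≤ α < 2π and a real u₀, and let k < k' be real numbers. Suppose e : ℕ → ℝ and e' : ℕ → ℝ are strictly increasing functions whose ranges are exactly S(α, u₀, V_k) and S(α, u₀, V_{k'}) respectively. Then for every n, e(n) < e'(n); that is, each eigenvalue in the increasing enumeration is a strictly increasing function of the parameter k. -/

import Mathlib

/-- The Morse potential `V_k(u) = (1/4)·exp(2u) + k·exp(u)`. -/
noncomputable def morse (k u : ℝ) : ℝ := (1/4) * Real.exp (2*u) + k * Real.exp u

open MeasureTheory in
/-- The set of eigenvalues of the Schrödinger operator `-d²/du² + V` on `[u₀,∞)`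
with boundary condition `cos α · ψ(u₀) + sin α · ψ'(u₀) = 0`. -/
def evSet (α u₀ : ℝ) (V : ℝ → ℝ) : Set ℝ :=
  {E | ∃ ψ : ℝ → ℝ,
    (∀ u, DifferentiableAt ℝ ψ u) ∧ (∀ u, DifferentiableAt ℝ (deriv ψ) u) ∧
    (∃ u, u₀ ≤ u ∧ ψ u ≠ 0) ∧
    IntegrableOn (fun u => (ψ u)^2) (Set.Ici u₀) ∧
    (∀ u, u₀ ≤ u → -(deriv (deriv ψ) u) + V u * ψ u = E * ψ u) ∧
    Real.cos α * ψ u₀ + Real.sin α * deriv ψ u₀ = 0}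

open Real Set Filter Topology

theorem sin_sq_sub (x y : ℝ) : sin y ^ 2 - sin x ^ 2 = sin (y - x) * sin (y + x) := by
  rw [sin_sub, sin_add]
  have h1 := sin_sq_add_cos_sq x
  have h2 := sin_sq_add_cos_sq y
  linear_combination (-sin y ^ 2) * h1 + sin x ^ 2 * h2

theorem abs_sin_sq_sub (x y : ℝ) : |sin y ^ 2 - sin x ^ 2| ≤ |y - x| := by
  rw [sin_sq_sub, abs_mul]
  have h1 : |sin (y - x)| ≤ |y - x| := Real.abs_sin_le_abs
  have h2 := abs_sin_le_one (y + x)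
  nlinarith [abs_nonneg (sin (y - x)), abs_nonneg (sin (y + x))]

noncomputable def prf (Q : ℝ → ℝ) (u x : ℝ) : ℝ := 1 + (Q u - 1) * sin x ^ 2

theorem prf_lip {Q : ℝ → ℝ} {u : ℝ} {C : NNReal} (h : |Q u - 1| ≤ C) : LipschitzWith C (prf Q u) := by
  apply LipschitzWith.of_dist_le_mul
  intro x y
  simp only [Real.dist_eq, prf]
  have : 1 + (Q u - 1) * sin x ^ 2 - (1 + (Q u - 1) * sin y ^ 2) = (Q u - 1) * (sin x ^ 2 - sin y ^ 2) := by ring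
  rw [this, abs_mul]
  exact mul_le_mul h (abs_sin_sq_sub _ _) (abs_nonneg _) C.2

theorem exists_bd {Q : ℝ → ℝ} (hQ : Continuous Q) (a b : ℝ) : ∃ C : NNReal, ∀ u ∈ Icc a b, |Q u - 1| ≤ C := by
  obtain ⟨C, hC⟩ := (isCompact_Icc (a := a) (b := b)).exists_bound_of_continuousOn
    (f := fun u => Q u - 1) (by fun_prop)
  refine ⟨C.toNNReal, fun u hu => ?_⟩
  have := hC u hu
  rw [Real.norm_eq_abs] at this
  exact this.trans (Real.le_coe_toNNReal C)

theorem prf_exists_loc {Q : ℝ → ℝ} (hQ : Continuous Q) (u₀ θ₀ : ℝ) (n : ℕ) :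
    ∃ g : ℝ → ℝ, g u₀ = θ₀ ∧ ∀ u ∈ Ioo (u₀ - (n + 1)) (u₀ + (n + 1)), HasDerivAt g (prf Q u (g u)) u := by
  obtain ⟨C, hC⟩ := exists_bd hQ (u₀ - (n + 1)) (u₀ + (n + 1))
  have hn : (0:ℝ) ≤ n := n.cast_nonneg
  have hp : IsPicardLindelof (prf Q) (tmin := u₀ - (n + 1)) (tmax := u₀ + (n + 1))
      ⟨u₀, by constructor <;> linarith⟩ θ₀ ((1 + C) * (n + 1)) 0 (1 + C) C := by
    refine ⟨fun t ht => (prf_lip (hC t ht)).lipschitzOnWith, fun x _ => ?_, fun t ht x _ => ?_, ?_⟩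
    · unfold prf; fun_prop
    · simp only [prf, Real.norm_eq_abs]
      refine (abs_add_le _ _).trans ?_
      rw [abs_mul, abs_one]
      push_cast
      have h1 := hC t ht
      have h2 : |sin x ^ 2| ≤ 1 := by rw [abs_of_nonneg (sq_nonneg _)]; exact sin_sq_le_one x
      nlinarith [abs_nonneg (Q t - 1), abs_nonneg (sin x ^ 2)]
    · simp
  obtain ⟨g, h0, hg⟩ := hp.exists_eq_forall_mem_Icc_hasDerivWithinAt₀
  exact ⟨g, h0, fun u hu => (hg u (Ioo_subset_Icc_self hu)).hasDerivAt (Icc_mem_nhds hu.1 hu.2)⟩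

theorem prf_exists {Q : ℝ → ℝ} (hQ : Continuous Q) (u₀ θ₀ : ℝ) :
    ∃ g : ℝ → ℝ, g u₀ = θ₀ ∧ ∀ u, HasDerivAt g (prf Q u (g u)) u := by
  choose g h0 hg using prf_exists_loc hQ u₀ θ₀
  have hag : ∀ n m : ℕ, n ≤ m → ∀ u ∈ Ioo (u₀ - (n + 1)) (u₀ + (n + 1)), g n u = g m u := by
    intro n m hnm u hu
    have hn : (0:ℝ) ≤ n := n.cast_nonneg
    have hnm' : (n:ℝ) ≤ m := by exact_mod_cast hnm
    obtain ⟨C, hC⟩ := exists_bd hQ (u₀ - (n + 1)) (u₀ + (n + 1))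
    refine ODE_solution_unique_of_mem_Ioo (v := prf Q) (s := fun _ => univ) (K := C) (t₀ := u₀)
      (fun t ht => (prf_lip (hC t (Ioo_subset_Icc_self ht))).lipschitzOnWith)
      (by constructor <;> linarith) (fun t ht => ⟨hg n t ht, trivial⟩)
      (fun t ht => ⟨hg m t ⟨by linarith [ht.1], by linarith [ht.2]⟩, trivial⟩) (by rw [h0, h0]) hu
  refine ⟨fun u => g ⌈|u - u₀|⌉₊ u, h0 _, fun u => ?_⟩
  have hmem : ∀ v, v ∈ Ioo (u₀ - (⌈|v - u₀|⌉₊ + 1)) (u₀ + (⌈|v - u₀|⌉₊ + 1)) := by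
    intro v
    have := Nat.le_ceil (|v - u₀|)
    have := abs_le.1 this
    constructor <;> linarith [this.1, this.2]
  have hu := hmem u
  set N := ⌈|u - u₀|⌉₊ with hN
  have key : (fun u => g ⌈|u - u₀|⌉₊ u) =ᶠ[𝓝 u] g (N + 1) := by
    filter_upwards [Ioo_mem_nhds hu.1 hu.2] with v hv
    apply hag _ _ _ _ (hmem v)
    apply Nat.ceil_le.2
    push_cast
    rw [abs_le]; constructor <;> linarith [hv.1, hv.2]
  have h1 := hg (N + 1) u ⟨by push_cast; linarith [hu.1], by push_cast; linarith [hu.2]⟩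
  have h2 := h1.congr_of_eventuallyEq key
  rw [← key.eq_of_nhds] at h2
  exact h2

theorem lin_mono {w a b : ℝ → ℝ} {s : ℝ} (ha : Continuous a)
    (hw : ∀ u, s ≤ u → HasDerivAt w (a u * w u + b u) u) (hb : ∀ u, s ≤ u → 0 ≤ b u) :
    ∃ I : ℝ → ℝ, (∀ u, 0 < I u) ∧ MonotoneOn (fun u => w u * I u) (Ici s) ∧
      (∀ u, s ≤ u → HasDerivAt (fun u => w u * I u) (b u * I u) u) := by
  refine ⟨fun u => exp (-∫ t in s..u, a t), fun u => exp_pos _, ?_⟩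
  have hd : ∀ u, s ≤ u → HasDerivAt (fun u => w u * exp (-∫ t in s..u, a t))
      (b u * exp (-∫ t in s..u, a t)) u := by
    intro u hu
    have h1 : HasDerivAt (fun u => ∫ t in s..u, a t) (a u) u :=
      ha.integral_hasStrictDerivAt s u |>.hasDerivAt
    refine ((hw u hu).mul h1.neg.exp).congr_deriv ?_
    simp only [Pi.neg_apply]
    ring
  refine ⟨?_, hd⟩
  apply monotoneOn_of_deriv_nonneg (convex_Ici s)
  · exact fun u hu => (hd u hu).continuousAt.continuousWithinAt
  · exact fun u hu => (hd u (interior_subset hu)).differentiableAt.differentiableWithinAt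
  · intro u hu
    rw [(hd u (interior_subset hu)).deriv]
    exact mul_nonneg (hb u (interior_subset hu)) (exp_pos _).le

theorem sin_eq_sinc (w : ℝ) : sin w = sinc w * w := by
  by_cases h : w = 0
  · simp [h]
  · rw [sinc_of_ne_zero h]; field_simp

theorem comp_le {Q x y x' y' : ℝ → ℝ} (hQ : Continuous Q) {s : ℝ}
    (hxc : Continuous x) (hyc : Continuous y)
    (hx : ∀ u, s ≤ u → HasDerivAt x (x' u) u) (hy : ∀ u, s ≤ u → HasDerivAt y (y' u) u)
    (h : ∀ u, s ≤ u → x' u - prf Q u (x u) ≤ y' u - prf Q u (y u)) (hs : x s ≤ y s) :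
    (∀ u, s ≤ u → x u ≤ y u) ∧
    (∀ u, s < u → x u = y u → ∀ t ∈ Ioo s u, x' t - prf Q t (x t) = y' t - prf Q t (y t)) := by
  obtain ⟨I, hI, hm, hd⟩ := lin_mono (w := fun u => y u - x u) (s := s)
    (a := fun u => (Q u - 1) * sinc (y u - x u) * sin (y u + x u))
    (b := fun u => (y' u - prf Q u (y u)) - (x' u - prf Q u (x u)))
    (by have := continuous_sinc; fun_prop)
    (by
      intro u hu
      refine ((hy u hu).sub (hx u hu)).congr_deriv ?_
      simp only [prf]
      have := sin_sq_sub (x u) (y u)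
      rw [sin_eq_sinc (y u - x u)] at this
      linear_combination (Q u - 1) * this)
    (fun u hu => by linarith [h u hu])
  constructor
  · intro u hu
    have h1 := hm (mem_Ici.2 le_rfl) (mem_Ici.2 hu) hu
    simp only at h1
    have h2 : 0 ≤ (y s - x s) * I s := mul_nonneg (by linarith) (hI s).le
    have h3 : 0 ≤ (y u - x u) * I u := h2.trans h1
    have := nonneg_of_mul_nonneg_left h3 (hI u)
    linarith
  · intro u hu he t ht
    have hz : ∀ v ∈ Ioo s u, (y v - x v) * I v = 0 := by
      intro v hv
      have h1 := hm (mem_Ici.2 le_rfl) (mem_Ici.2 hv.1.le) hv.1.le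
      have h4 := hm (mem_Ici.2 hv.1.le) (mem_Ici.2 hu.le) hv.2.le
      simp only [he, sub_self, zero_mul] at h1 h4
      have h2 : 0 ≤ (y s - x s) * I s := mul_nonneg (by linarith) (hI s).le
      linarith
    have h5 : (fun v => (y v - x v) * I v) =ᶠ[𝓝 t] fun _ => 0 := by
      filter_upwards [Ioo_mem_nhds ht.1 ht.2] with v hv using hz v hv
    have h6 := (hd t ht.1.le).congr_of_eventuallyEq h5.symm
    have h7 := h6.unique (hasDerivAt_const t (0:ℝ))
    rcases mul_eq_zero.1 h7 with h | h
    · linarith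
    · exact absurd h (hI t).ne'

def Pr (Q : ℝ → ℝ) (u₀ θ₀ : ℝ) (θ : ℝ → ℝ) : Prop :=
  θ u₀ = θ₀ ∧ ∀ u, HasDerivAt θ (prf Q u (θ u)) u

theorem Pr.cont {Q : ℝ → ℝ} {u₀ θ₀ : ℝ} {θ : ℝ → ℝ} (h : Pr Q u₀ θ₀ θ) : Continuous θ :=
  continuous_iff_continuousAt.2 fun u => (h.2 u).continuousAt

theorem Pr.mono {Q Q' : ℝ → ℝ} (hQ : Continuous Q) {u₀ θ₀ : ℝ} {θ θ' : ℝ → ℝ}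
    (h : Pr Q u₀ θ₀ θ) (h' : Pr Q' u₀ θ₀ θ') (hle : ∀ u, u₀ ≤ u → Q u ≤ Q' u) :
    ∀ u, u₀ ≤ u → θ u ≤ θ' u := by
  refine (comp_le hQ h.cont h'.cont (fun u _ => h.2 u) (fun u _ => h'.2 u) ?_ ?_).1
  · intro u hu
    simp only [prf]
    nlinarith [hle u hu, sq_nonneg (sin (θ' u))]
  · rw [h.1, h'.1]

theorem Pr.smono {Q Q' : ℝ → ℝ} (hQ : Continuous Q) {u₀ θ₀ : ℝ} {θ θ' : ℝ → ℝ}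
    (h : Pr Q u₀ θ₀ θ) (h' : Pr Q' u₀ θ₀ θ') (hlt : ∀ u, u₀ ≤ u → Q u < Q' u) :
    ∀ u, u₀ < u → θ u < θ' u := by
  have key := comp_le hQ h.cont h'.cont (s := u₀) (fun u _ => h.2 u) (fun u _ => h'.2 u)
    (by
      intro u hu
      simp only [prf]
      nlinarith [hlt u hu, sq_nonneg (sin (θ' u))])
    (by rw [h.1, h'.1])
  intro u hu
  refine lt_of_le_of_ne (key.1 u hu.le) fun he => ?_
  have h2 := key.2 u hu he
  have hz : ∀ t ∈ Ioo u₀ u, sin (θ' t) = 0 := by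
    intro t ht
    have := h2 t ht
    simp only [prf] at this
    have h3 : (Q' t - Q t) * sin (θ' t) ^ 2 = 0 := by linarith
    rcases mul_eq_zero.1 h3 with h4 | h4
    · linarith [hlt t ht.1.le]
    · exact pow_eq_zero_iff (two_ne_zero) |>.1 h4
  obtain ⟨t, ht⟩ := nonempty_Ioo.2 hu
  have h5 : (fun v => sin (θ' v)) =ᶠ[𝓝 t] fun _ => 0 := by
    filter_upwards [Ioo_mem_nhds ht.1 ht.2] with v hv using hz v hv
  have h6 := (h'.2 t).sin.congr_of_eventuallyEq h5.symm
  have h7 := h6.unique (hasDerivAt_const t (0:ℝ))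
  simp only [prf, hz t ht] at h7
  have := sin_sq_add_cos_sq (θ' t)
  rw [hz t ht] at this
  have h8 : cos (θ' t) = 0 := by linarith
  rw [h8] at this
  norm_num at this

theorem sin_lev (m : ℕ) : sin (m * π) = 0 := sin_nat_mul_pi m

theorem Pr.level {Q : ℝ → ℝ} (hQ : Continuous Q) {u₀ θ₀ : ℝ} {θ : ℝ → ℝ}
    (h : Pr Q u₀ θ₀ θ) (m : ℕ) {s : ℝ} (hs : m * π ≤ θ s) :
    ∀ u, s < u → m * π < θ u := by
  have key := comp_le hQ (x := fun _ => m * π) (x' := fun _ => 0) (s := s) continuous_const h.cont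
    (fun u _ => hasDerivAt_const u _) (fun u _ => h.2 u)
    (by
      intro u hu
      simp only [prf, sin_lev]
      norm_num) hs
  intro u hu
  refine lt_of_le_of_ne (key.1 u hu.le) fun he => ?_
  obtain ⟨t, ht⟩ := nonempty_Ioo.2 hu
  have := key.2 u hu he t ht
  simp only [prf, sin_lev] at this
  norm_num at this

theorem Pr.barrier {Q : ℝ → ℝ} (hQ : Continuous Q) {u₀ θ₀ : ℝ} {θ : ℝ → ℝ}
    (h : Pr Q u₀ θ₀ θ) {β s : ℝ} (hs : θ s ≤ β) (hb : ∀ u, s ≤ u → prf Q u β ≤ 0) :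
    ∀ u, s ≤ u → θ u ≤ β := by
  refine (comp_le hQ (y := fun _ => β) (y' := fun _ => 0) (s := s) h.cont continuous_const
    (fun u _ => h.2 u) (fun u _ => hasDerivAt_const u _) ?_ hs).1
  intro u hu
  have := hb u hu
  linarith

theorem sin_half (m : ℕ) : sin (m * π + π / 2) ^ 2 = 1 := by
  rw [sin_add_pi_div_two]
  have h := sin_sq_add_cos_sq (m * π)
  rw [sin_lev] at h
  linarith

theorem Pr.half {Q : ℝ → ℝ} (hQ : Continuous Q) {u₀ θ₀ : ℝ} {θ : ℝ → ℝ}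
    (h : Pr Q u₀ θ₀ θ) (m : ℕ) {s : ℝ} (hs : θ s ≤ m * π + π / 2) (hb : ∀ u, s ≤ u → Q u ≤ 0) :
    ∀ u, s ≤ u → θ u ≤ m * π + π / 2 := by
  refine h.barrier hQ hs fun u hu => ?_
  simp only [prf, sin_half]
  linarith [hb u hu]

theorem Pr.contE {Q : ℝ → ℝ} (hQ : Continuous Q) {u₀ θ₀ : ℝ} {θ : ℝ → ℝ}
    (h : Pr Q u₀ θ₀ θ) {u ε : ℝ} (hu : u₀ ≤ u) (hε : 0 < ε) :
    ∃ δ > 0, ∀ d θ', |d| < δ → Pr (fun u => Q u + d) u₀ θ₀ θ' → |θ' u - θ u| < ε := by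
  obtain ⟨C, hC⟩ := exists_bd hQ u₀ u
  have hc := (gronwallBound_continuous_ε 0 C (u - u₀)).tendsto 0
  rw [gronwallBound_ε0_δ0] at hc
  obtain ⟨δ, hδ, hd⟩ := Metric.eventually_nhds_iff.1 (hc.eventually (gt_mem_nhds hε))
  refine ⟨δ, hδ, fun d θ' hd' h' => ?_⟩
  have h1 := norm_le_gronwallBound_of_norm_deriv_right_le (f := fun t => θ' t - θ t)
    (f' := fun t => prf (fun u => Q u + d) t (θ' t) - prf Q t (θ t)) (δ := 0) (K := C) (ε := |d|)
    (a := u₀) (b := u) (by have := h.cont; have := h'.cont; fun_prop)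
    (fun t _ => ((h'.2 t).sub (h.2 t)).hasDerivWithinAt) (by simp [h.1, h'.1])
    (by
      intro t ht
      simp only [Real.norm_eq_abs]
      have e1 : prf (fun u => Q u + d) t (θ' t) - prf Q t (θ t) =
        (prf Q t (θ' t) - prf Q t (θ t)) + d * sin (θ' t) ^ 2 := by simp only [prf]; ring
      rw [e1]
      refine (abs_add_le _ _).trans (add_le_add ?_ ?_)
      · have := (prf_lip (hC t (Ico_subset_Icc_self ht))).dist_le_mul (θ' t) (θ t)
        simpa [Real.dist_eq] using this
      · rw [abs_mul, abs_of_nonneg (sq_nonneg (sin (θ' t)))]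
        have := sin_sq_le_one (θ' t)
        nlinarith [abs_nonneg d])
    u ⟨hu, le_rfl⟩
  have h2 := @hd |d| (by simpa [Real.dist_eq] using hd')
  rw [Real.norm_eq_abs] at h1
  linarith

def Dec (θ : ℝ → ℝ) (m : ℕ) : Prop :=
  ∃ X, ∀ u, X ≤ u → m * π + π / 2 ≤ θ u ∧ θ u < (m + 1) * π

theorem Dec.unique {θ : ℝ → ℝ} {m n : ℕ} (h : Dec θ m) (h' : Dec θ n) : m = n := by
  obtain ⟨X, hX⟩ := h
  obtain ⟨Y, hY⟩ := h'
  have a := hX _ (le_max_left X Y)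
  have b := hY _ (le_max_right X Y)
  have hp := pi_pos
  have h1 : (m:ℝ) < n + 1 := lt_of_mul_lt_mul_right (by linarith : (m:ℝ) * π < (n + 1) * π) hp.le
  have h2 : (n:ℝ) < m + 1 := lt_of_mul_lt_mul_right (by linarith : (n:ℝ) * π < (m + 1) * π) hp.le
  norm_cast at h1 h2
  omega

theorem le_sub_of_deriv_le {f f' : ℝ → ℝ} {s c : ℝ} (hf : ∀ u, HasDerivAt f (f' u) u)
    (h : ∀ u, s ≤ u → f' u ≤ c) : ∀ u, s ≤ u → f u ≤ f s + c * (u - s) := by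
  intro u hu
  have hd : ∀ u, HasDerivAt (fun u => f u - c * u) (f' u - c) u := fun u =>
    ((hf u).sub ((hasDerivAt_id u).const_mul c)).congr_deriv (by ring)
  have : AntitoneOn (fun u => f u - c * u) (Ici s) := by
    apply antitoneOn_of_deriv_nonpos (convex_Ici s)
    · exact fun u _ => (hd u).continuousAt.continuousWithinAt
    · exact fun u _ => (hd u).differentiableAt.differentiableWithinAt
    · intro u hu
      rw [(hd u).deriv]
      linarith [h u (interior_subset hu)]
  have := this (mem_Ici.2 le_rfl) (mem_Ici.2 hu) hu
  simp only at this
  linarith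

theorem Pr.jump {Q Q' : ℝ → ℝ} (hQ : Continuous Q) (hlim : Tendsto Q atTop atBot)
    {u₀ θ₀ : ℝ} {θ θ' : ℝ → ℝ}
    (h : Pr Q u₀ θ₀ θ) (h' : Pr Q' u₀ θ₀ θ') (hlt : ∀ u, u₀ ≤ u → Q u < Q' u)
    {m : ℕ} (hm : Dec θ m) : ∃ u, u₀ ≤ u ∧ (m + 1) * π ≤ θ' u := by
  by_contra! hcon
  obtain ⟨X₀, hX₀⟩ := hm
  obtain ⟨X₁, hX₁⟩ := (eventually_atTop.1 (hlim.eventually (eventually_le_atBot 0)))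
  set X := max X₀ (max X₁ (u₀ + 1)) with hX
  have a0 : X₀ ≤ X := le_max_left _ _
  have a1 : X₁ ≤ X := (le_max_left _ _).trans (le_max_right _ _)
  have a2 : u₀ + 1 ≤ X := (le_max_right _ _).trans (le_max_right _ _)
  have hp := pi_pos
  have hsm := h.smono hQ h' hlt
  have hd : ∀ u, HasDerivAt (fun u => θ' u - θ u) (prf Q' u (θ' u) - prf Q u (θ u)) u := fun u =>
    (h'.2 u).sub (h.2 u)
  have hmono : MonotoneOn (fun u => θ' u - θ u) (Ici X) := by
    apply monotoneOn_of_deriv_nonneg (convex_Ici X)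
    · exact fun u _ => (hd u).continuousAt.continuousWithinAt
    · exact fun u _ => (hd u).differentiableAt.differentiableWithinAt
    · intro u hu
      rw [(hd u).deriv]
      have hu : X ≤ u := interior_subset hu
      have e1 : prf Q' u (θ' u) - prf Q u (θ u) =
        (Q' u - Q u) * sin (θ' u) ^ 2 + (1 - Q u) * (-(sin (θ' u) ^ 2 - sin (θ u) ^ 2)) := by
        simp only [prf]; ring
      have b1 := hX₀ u (by linarith)
      have b2 := hcon u (by linarith)
      have b3 := hsm u (by linarith)
      have b4 := hlt u (by linarith)
      have b5 := hX₁ u (by linarith)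
      rw [e1]
      apply add_nonneg
      · exact mul_nonneg (by linarith) (sq_nonneg _)
      · apply mul_nonneg (by linarith)
        rw [sin_sq_sub]
        have c1 : 0 ≤ sin (θ' u - θ u) := sin_nonneg_of_nonneg_of_le_pi (by linarith) (by linarith)
        have c2 : sin (θ' u + θ u) ≤ 0 := by
          have : θ' u + θ u = (θ' u + θ u - ((m + 1 : ℕ) : ℝ) * (2 * π)) + ((m + 1 : ℕ) : ℝ) * (2 * π) := by ring
          rw [this, sin_add_nat_mul_two_pi]
          push_cast
          apply sin_nonpos_of_nonpos_of_neg_pi_le <;> linarith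
        nlinarith
  set δ := θ' X - θ X with hδ
  have hδ0 : 0 < δ := by have := hsm X (by linarith); linarith
  have hδ1 : δ ≤ π / 2 := by
    have := hX₀ X a0
    have := hcon X (by linarith)
    linarith
  have hs : 0 < sin δ := sin_pos_of_pos_of_lt_pi hδ0 (by linarith)
  have hsin : ∀ u, X ≤ u → sin δ ^ 2 ≤ sin (θ u) ^ 2 := by
    intro u hu
    have c1 := hmono (mem_Ici.2 le_rfl) (mem_Ici.2 hu) hu
    simp only at c1
    have c2 := hcon u (by linarith)
    have c3 := hX₀ u (by linarith)
    have c4 : sin δ ≤ sin (((m + 1 : ℕ):ℝ) * π - θ u) := by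
      push_cast
      apply sin_le_sin_of_le_of_le_pi_div_two <;> linarith
    have c5 : sin (((m + 1 : ℕ):ℝ) * π - θ u) ^ 2 = sin (θ u) ^ 2 := by
      rw [sin_sub, sin_lev]
      have := sin_sq_add_cos_sq (((m + 1 : ℕ):ℝ) * π)
      rw [sin_lev] at this
      linear_combination sin (θ u) ^ 2 * this
    rw [← c5]
    nlinarith
  obtain ⟨X₂, hX₂⟩ := (eventually_atTop.1 (hlim.eventually (eventually_le_atBot (1 - 2 / sin δ ^ 2))))
  have c0 := le_sub_of_deriv_le (s := max X X₂) (c := -1) h.2 (by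
    intro u hu
    have d1 := hX₂ u ((le_max_right _ _).trans hu)
    have d2 := hsin u ((le_max_left _ _).trans hu)
    have d3 : 0 < sin δ ^ 2 := by positivity
    have d4 : 2 / sin δ ^ 2 * sin δ ^ 2 = 2 := by field_simp
    have d5 : 0 < 2 / sin δ ^ 2 := by positivity
    simp only [prf]
    nlinarith)
  have f1 := c0 (max X X₂ + π) (by linarith)
  have f2 := hX₀ (max X X₂) (a0.trans (le_max_left _ _))
  have f3 := hX₀ (max X X₂ + π) (by have := a0.trans (le_max_left X X₂); linarith)
  linarith

theorem exists_dec {V : ℝ → ℝ} (hV : Continuous V) (hlim : Tendsto V atTop atTop) {u₀ θ₀ : ℝ}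
    (h0 : 0 ≤ θ₀) (h1 : θ₀ < π) {Θ : ℝ → ℝ → ℝ} (hΘ : ∀ E, Pr (fun u => E - V u) u₀ θ₀ (Θ E))
    {E u₁ : ℝ} {m : ℕ} (hu₁ : u₀ ≤ u₁) (hE : (m + 1) * π ≤ Θ E u₁) :
    ∃ E', E' < E ∧ Dec (Θ E') m := by
  have hp := pi_pos
  have hQ : ∀ E, Continuous (fun u => E - V u) := fun E => by fun_prop
  set A := {E | ∃ u, u₀ ≤ u ∧ (m + 1) * π ≤ Θ E u} with hA
  have hEA : E ∈ A := ⟨u₁, hu₁, hE⟩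
  have hlev : ∀ E u v, u < v → (m + 1) * π ≤ Θ E u → (m + 1) * π < Θ E v := by
    intro E u v huv h
    have := (hΘ E).level (hQ E) (m + 1) (s := u) (by push_cast; exact h) v huv
    push_cast at this
    exact this
  have hbdd : BddBelow A := by
    obtain ⟨X, hX⟩ := eventually_atTop.1 (hlim.eventually (eventually_ge_atTop 0))
    obtain ⟨C, hC⟩ := exists_bd hV u₀ X
    have hVb : ∀ u, u₀ ≤ u → -(C:ℝ) ≤ V u := by
      intro u hu
      have hC0 : (0:ℝ) ≤ C := C.2
      rcases le_total X u with h | h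
      · linarith [hX u h]
      · have := (abs_le.1 (hC u ⟨hu, h⟩)).1
        linarith
    set β := max θ₀ (π / 2) with hβ
    have hβ1 : θ₀ ≤ β := le_max_left _ _
    have hβ2 : π / 2 ≤ β := le_max_right _ _
    have hβ3 : β < π := max_lt h1 (by linarith)
    have hs : 0 < sin β := sin_pos_of_pos_of_lt_pi (by linarith) hβ3
    refine ⟨-C - 1 / sin β ^ 2, ?_⟩
    rintro E' ⟨u, hu, hE'⟩
    by_contra! hlt
    have := (hΘ E').barrier (hQ E') (β := β) (s := u₀) (by rw [(hΘ E').1]; exact hβ1) (by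
      intro v hv
      have d1 := hVb v hv
      have d3 : 0 < sin β ^ 2 := by positivity
      have d4 : 1 / sin β ^ 2 * sin β ^ 2 = 1 := by field_simp
      simp only [prf]
      nlinarith) u hu
    have hm : (0:ℝ) ≤ m := m.cast_nonneg
    nlinarith
  set E₀ := sInf A with hE₀
  have hnot : E₀ ∉ A := by
    rintro ⟨u, hu, h⟩
    have h2 := hlev E₀ u (u + 1) (by linarith) h
    obtain ⟨δ, hδ, hd⟩ := (hΘ E₀).contE (hQ E₀) (u := u + 1) (by linarith) (sub_pos.2 h2)
    have h3 := hd (-(δ / 2)) (Θ (E₀ - δ / 2)) (by rw [abs_neg, abs_of_pos (by positivity)]; linarith) (by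
      convert hΘ (E₀ - δ / 2) using 2
      ring)
    have h4 := (abs_lt.1 h3).1
    have h5 : E₀ - δ / 2 ∈ A := ⟨u + 1, by linarith, by linarith⟩
    have := csInf_le hbdd h5
    linarith
  refine ⟨E₀, lt_of_le_of_ne (csInf_le hbdd hEA) (fun h => hnot (h ▸ hEA)), ?_⟩
  have hup : ∀ u, u₀ ≤ u → Θ E₀ u < (m + 1) * π := by
    intro u hu
    by_contra! h
    exact hnot ⟨u, hu, h⟩
  obtain ⟨X, hX⟩ := eventually_atTop.1 (hlim.eventually (eventually_ge_atTop (E₀ + 1)))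
  refine ⟨max X u₀, fun u hu => ⟨?_, hup u ((le_max_right _ _).trans hu)⟩⟩
  by_contra! hlt
  have hu0 : u₀ ≤ u := (le_max_right _ _).trans hu
  have huX : X ≤ u := (le_max_left _ _).trans hu
  obtain ⟨δ, hδ, hd⟩ := (hΘ E₀).contE (hQ E₀) (u := u) hu0 (sub_pos.2 hlt)
  obtain ⟨E', hE'A, hE'⟩ := exists_lt_of_csInf_lt ⟨E, hEA⟩
    (show sInf A < E₀ + min δ 1 by have : 0 < min δ 1 := by positivity
                                   linarith)
  have hge : E₀ ≤ E' := csInf_le hbdd hE'A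
  have hm1 := min_le_left δ 1
  have hm2 := min_le_right δ 1
  have h3 := hd (E' - E₀) (Θ E') (by rw [abs_of_nonneg (by linarith)]; linarith) (by
      convert hΘ E' using 2
      ring)
  have h4 := (abs_lt.1 h3).2
  have h5 := (hΘ E').half (hQ E') m (s := u) (by linarith) (by
    intro v hv
    have := hX v (by linarith)
    linarith)
  obtain ⟨v, hv, hvA⟩ := hE'A
  rcases le_or_gt u v with h | h
  · have := h5 v h
    linarith
  · have := hlev E' v u h hvA
    linarith

theorem lin_zero {w a : ℝ → ℝ} {s t : ℝ} (ha : Continuous a)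
    (hw : ∀ u, s ≤ u → HasDerivAt w (a u * w u) u) (ht : s ≤ t) (h0 : w t = 0) :
    ∀ u, s ≤ u → w u = 0 := by
  obtain ⟨I, hI, hm, hd⟩ := lin_mono (w := w) (a := a) (b := fun _ => 0) (s := s) ha
    (fun u hu => (hw u hu).congr_deriv (by ring)) (fun _ _ => le_rfl)
  have han : AntitoneOn (fun u => w u * I u) (Ici s) := by
    apply antitoneOn_of_deriv_nonpos (convex_Ici s)
    · exact fun u hu => (hd u hu).continuousAt.continuousWithinAt
    · exact fun u hu => (hd u (interior_subset hu)).differentiableAt.differentiableWithinAt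
    · intro u hu
      rw [(hd u (interior_subset hu)).deriv]
      simp
  have heq : ∀ u, s ≤ u → w u * I u = w s * I s := fun u hu =>
    le_antisymm (han (mem_Ici.2 le_rfl) (mem_Ici.2 hu) hu) (hm (mem_Ici.2 le_rfl) (mem_Ici.2 hu) hu)
  intro u hu
  have h1 := heq u hu
  rw [← heq t ht, h0, zero_mul] at h1
  exact (mul_eq_zero.1 h1).resolve_right (hI u).ne'

open MeasureTheory in
theorem mem_of_dec {V : ℝ → ℝ} (hV : Continuous V) (hlim : Tendsto V atTop atTop) {α u₀ θ₀ E : ℝ}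
    (hα : cos α * sin θ₀ + sin α * cos θ₀ = 0) {θ : ℝ → ℝ} (h : Pr (fun u => E - V u) u₀ θ₀ θ)
    {m : ℕ} (hm : Dec θ m) : E ∈ evSet α u₀ V := by
  have hp := pi_pos
  have hθ := h.cont
  set r : ℝ → ℝ := fun u => exp (∫ t in u₀..u, (1 - (E - V t)) * (sin (θ t) * cos (θ t))) with hr
  have hrd : ∀ u, HasDerivAt r (r u * ((1 - (E - V u)) * (sin (θ u) * cos (θ u)))) u := by
    intro u
    have hc : Continuous fun t => (1 - (E - V t)) * (sin (θ t) * cos (θ t)) := by fun_prop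
    exact (hc.integral_hasStrictDerivAt u₀ u).hasDerivAt.exp
  have hrpos : ∀ u, 0 < r u := fun u => exp_pos _
  set ψ : ℝ → ℝ := fun u => r u * sin (θ u) with hψ
  set χ : ℝ → ℝ := fun u => r u * cos (θ u) with hχ
  have hd1 : ∀ u, HasDerivAt ψ (χ u) u := by
    intro u
    refine ((hrd u).mul (h.2 u).sin).congr_deriv ?_
    simp only [prf, hχ]
    ring
  have hd2 : ∀ u, HasDerivAt χ (-(E - V u) * ψ u) u := by
    intro u
    refine ((hrd u).mul (h.2 u).cos).congr_deriv ?_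
    simp only [prf, hψ]
    linear_combination r u * sin (θ u) * (1 - (E - V u)) * sin_sq_add_cos_sq (θ u)
  have hder : deriv ψ = χ := funext fun u => (hd1 u).deriv
  have hψc : Continuous ψ := continuous_iff_continuousAt.2 fun u => (hd1 u).continuousAt
  refine ⟨ψ, fun u => (hd1 u).differentiableAt, ?_, ?_, ?_, ?_, ?_⟩
  · rw [hder]; exact fun u => (hd2 u).differentiableAt
  · by_contra! hz
    have hz' : ∀ u, u₀ ≤ u → sin (θ u) = 0 := fun u hu =>
      (mul_eq_zero.1 (hz u hu)).resolve_left (hrpos u).ne'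
    have h5 : (fun v => sin (θ v)) =ᶠ[𝓝 (u₀ + 1)] fun _ => 0 := by
      filter_upwards [Ioi_mem_nhds (show u₀ < u₀ + 1 by linarith)] with v hv using hz' v (le_of_lt hv)
    have h6 := (h.2 (u₀ + 1)).sin.congr_of_eventuallyEq h5.symm
    have h7 := h6.unique (hasDerivAt_const (u₀ + 1) (0:ℝ))
    have h8 := hz' (u₀ + 1) (by linarith)
    simp only [prf, h8] at h7
    have := sin_sq_add_cos_sq (θ (u₀ + 1))
    rw [h8] at this
    have h9 : cos (θ (u₀ + 1)) = 0 := by linarith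
    rw [h9] at this
    norm_num at this
  · obtain ⟨X₀, hX₀⟩ := hm
    obtain ⟨X₁, hX₁⟩ := eventually_atTop.1 (hlim.eventually (eventually_ge_atTop (E + 1)))
    set X := max X₀ X₁ with hX
    have hsq : Continuous fun u => ψ u ^ 2 := by fun_prop
    have hneg : ∀ u, X ≤ u → ψ u * χ u ≤ 0 := by
      intro u hu
      obtain ⟨a1, a2⟩ := hX₀ u ((le_max_left _ _).trans hu)
      have e : ψ u * χ u = r u ^ 2 * sin (2 * θ u) / 2 := by
        simp only [hψ, hχ, sin_two_mul]; ring
      have : 2 * θ u = (2 * θ u - ((m + 1 : ℕ) : ℝ) * (2 * π)) + ((m + 1 : ℕ) : ℝ) * (2 * π) := by ring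
      have s : sin (2 * θ u) ≤ 0 := by
        rw [this, sin_add_nat_mul_two_pi]
        push_cast
        apply sin_nonpos_of_nonpos_of_neg_pi_le <;> linarith
      rw [e]
      nlinarith [sq_nonneg (r u)]
    have hI : IntegrableOn (fun u => ψ u ^ 2) (Ioi X) := by
      refine integrableOn_Ioi_of_intervalIntegral_norm_bounded (l := atTop) (b := id)
        (-(ψ X * χ X)) X (fun i => hsq.integrableOn_Ioc) tendsto_id ?_
      filter_upwards [eventually_ge_atTop X] with b hb
      have hG : ∀ u, HasDerivAt (fun u => (∫ t in X..u, ψ t ^ 2) - ψ u * χ u)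
          (ψ u ^ 2 - (χ u * χ u + ψ u * (-(E - V u) * ψ u))) u := fun u =>
        (hsq.integral_hasStrictDerivAt X u).hasDerivAt.sub ((hd1 u).mul (hd2 u))
      have := le_sub_of_deriv_le (s := X) (c := 0) hG (by
        intro u hu
        have := hX₁ u ((le_max_right _ _).trans hu)
        nlinarith [sq_nonneg (χ u), sq_nonneg (ψ u)]) b hb
      simp only [intervalIntegral.integral_same] at this
      have e : (∫ t in X..id b, ‖ψ t ^ 2‖) = ∫ t in X..b, ψ t ^ 2 := by
        simp only [id]
        congr 1
        ext t
        rw [Real.norm_eq_abs, abs_of_nonneg (sq_nonneg _)]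
      rw [e]
      have := hneg b hb
      linarith
    have h2 : IntegrableOn (fun u => ψ u ^ 2) (Icc u₀ X) := hsq.integrableOn_Icc
    refine (h2.union hI).mono_set ?_
    intro u hu
    rcases le_or_gt u X with h | h
    · exact Or.inl ⟨hu, h⟩
    · exact Or.inr h
  · intro u _
    rw [hder, (hd2 u).deriv]
    ring
  · rw [hder]
    simp only [hψ, hχ, h.1]
    linear_combination r u₀ * hα

open MeasureTheory in
theorem dec_of_mem {V : ℝ → ℝ} (hV : Continuous V) (hlim : Tendsto V atTop atTop) {α u₀ θ₀ E : ℝ}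
    (hα : cos α * sin θ₀ + sin α * cos θ₀ = 0) (h0 : 0 ≤ θ₀)
    {θ : ℝ → ℝ} (h : Pr (fun u => E - V u) u₀ θ₀ θ)
    (hE : E ∈ evSet α u₀ V) : ∃ m, Dec θ m := by
  have hp := pi_pos
  have hθ := h.cont
  have hQ : Continuous (fun u => E - V u) := by fun_prop
  obtain ⟨ψ, hψ1, hψ2, ⟨v₀, hv₀, hv₀'⟩, hint, hode, hbc⟩ := hE
  have hd1 : ∀ u, HasDerivAt ψ (deriv ψ u) u := fun u => (hψ1 u).hasDerivAt
  have hd2 : ∀ u, u₀ ≤ u → HasDerivAt (deriv ψ) (-(E - V u) * ψ u) u := fun u hu =>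
    (hψ2 u).hasDerivAt.congr_deriv (by linarith [hode u hu])
  set χ := deriv ψ with hχ
  have hW : ∀ u, u₀ ≤ u → ψ u * cos (θ u) - χ u * sin (θ u) = 0 := by
    refine lin_zero (w := fun u => ψ u * cos (θ u) - χ u * sin (θ u))
      (a := fun u => -((1 - (E - V u)) * (sin (θ u) * cos (θ u)))) (s := u₀) (t := u₀)
      (by fun_prop) ?_ le_rfl ?_
    · intro u hu
      refine (((hd1 u).mul (h.2 u).cos).sub ((hd2 u hu).mul (h.2 u).sin)).congr_deriv ?_
      simp only [prf]
      linear_combination (ψ u * sin (θ u) * (1 - (E - V u))) * sin_sq_add_cos_sq (θ u)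
    · simp only [h.1]
      have e1 := sin_sq_add_cos_sq α
      have e3 : sin α * (ψ u₀ * cos θ₀ - χ u₀ * sin θ₀) = 0 := by
        linear_combination ψ u₀ * hα - sin θ₀ * hbc
      have e4 : cos α * (ψ u₀ * cos θ₀ - χ u₀ * sin θ₀) = 0 := by
        linear_combination cos θ₀ * hbc - χ u₀ * hα
      linear_combination sin α * e3 + cos α * e4 - (ψ u₀ * cos θ₀ - χ u₀ * sin θ₀) * e1
  have hρd : ∀ u, u₀ ≤ u → HasDerivAt (fun u => ψ u * sin (θ u) + χ u * cos (θ u))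
      ((1 - (E - V u)) * (sin (θ u) * cos (θ u)) * (ψ u * sin (θ u) + χ u * cos (θ u))) u := by
    intro u hu
    refine (((hd1 u).mul (h.2 u).sin).add ((hd2 u hu).mul (h.2 u).cos)).congr_deriv ?_
    have := hW u hu
    simp only [prf]
    linear_combination (1 - (E - V u)) * (cos (θ u) ^ 2 - sin (θ u) ^ 2) * this -
      ψ u * cos (θ u) * (1 - (E - V u)) * sin_sq_add_cos_sq (θ u)
  have hψρ : ∀ u, u₀ ≤ u → ψ u = (ψ u * sin (θ u) + χ u * cos (θ u)) * sin (θ u) := by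
    intro u hu
    linear_combination cos (θ u) * hW u hu - ψ u * sin_sq_add_cos_sq (θ u)
  have hχρ : ∀ u, u₀ ≤ u → χ u = (ψ u * sin (θ u) + χ u * cos (θ u)) * cos (θ u) := by
    intro u hu
    linear_combination -sin (θ u) * hW u hu - χ u * sin_sq_add_cos_sq (θ u)
  have hρ : ∀ u, u₀ ≤ u → ψ u * sin (θ u) + χ u * cos (θ u) ≠ 0 := by
    intro u hu hz
    have := lin_zero (w := fun u => ψ u * sin (θ u) + χ u * cos (θ u))
      (a := fun u => (1 - (E - V u)) * (sin (θ u) * cos (θ u))) (by fun_prop) hρd hu hz v₀ hv₀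
    apply hv₀'
    rw [hψρ v₀ hv₀, this, zero_mul]
  obtain ⟨X₁, hX₁⟩ := eventually_atTop.1 (hlim.eventually (eventually_ge_atTop (E + 1)))
  set X := max X₁ u₀ with hX
  have hX0 : u₀ ≤ X := le_max_right _ _
  have hng : ∀ (j : ℕ) (s : ℝ), X ≤ s → j * π ≤ θ s → j * π + π / 2 < θ s := by
    intro j s hs hj
    by_contra! hj2
    have g1 : ∀ u, s ≤ u → j * π ≤ θ u := by
      intro u hu
      rcases hu.eq_or_lt with rfl | hu
      · exact hj
      · exact (h.level hQ j hj u hu).le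
    have g2 := h.half hQ j hj2 (by
      intro u hu
      have := hX₁ u ((le_max_left _ _).trans (hs.trans hu))
      linarith)
    have hmono : MonotoneOn (fun u => ψ u ^ 2) (Ici s) := by
      have hd : ∀ u, HasDerivAt (fun u => ψ u ^ 2) (2 * (ψ u * χ u)) u := fun u =>
        ((hd1 u).pow 2).congr_deriv (by simp; ring)
      apply monotoneOn_of_deriv_nonneg (convex_Ici s)
      · exact fun u _ => (hd u).continuousAt.continuousWithinAt
      · exact fun u _ => (hd u).differentiableAt.differentiableWithinAt
      · intro u hu
        have hu : s ≤ u := interior_subset hu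
        rw [(hd u).deriv]
        have hu0 : u₀ ≤ u := hX0.trans (hs.trans hu)
        have b1 := g1 u hu
        have b2 := g2 u hu
        have hsn : 0 ≤ sin (2 * θ u) := by
          have : 2 * θ u = (2 * θ u - (j : ℝ) * (2 * π)) + (j : ℝ) * (2 * π) := by ring
          rw [this, sin_add_nat_mul_two_pi]
          apply sin_nonneg_of_nonneg_of_le_pi <;> linarith
        rw [sin_two_mul] at hsn
        have e1 : ψ u * χ u = _ := congrArg₂ (· * ·) (hψρ u hu0) (hχρ u hu0)
        have e2 : 2 * (ψ u * χ u)
          = (ψ u * sin (θ u) + χ u * cos (θ u)) ^ 2 * (2 * sin (θ u) * cos (θ u)) := by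
          linear_combination 2 * e1
        rw [e2]
        exact mul_nonneg (sq_nonneg _) hsn
    have hz : ∀ u, s ≤ u → ψ u = 0 := by
      intro u hu
      by_contra hne
      have hpos : 0 < ψ u ^ 2 := by positivity
      have hu0 : u₀ ≤ u := hX0.trans (hs.trans hu)
      have hI : IntegrableOn (fun _ : ℝ => ψ u ^ 2) (Ici u) := by
        refine (hint.mono_set (Ici_subset_Ici.2 hu0)).mono' (by fun_prop) ?_
        refine (ae_restrict_iff' measurableSet_Ici).2 (Eventually.of_forall fun v hv => ?_)
        rw [Real.norm_eq_abs, abs_of_nonneg hpos.le]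
        exact hmono (mem_Ici.2 hu) (mem_Ici.2 (hu.trans hv)) hv
      rw [integrableOn_const_iff] at hI
      simp at hI
      exact hne hI
    have h5 : ψ =ᶠ[𝓝 (s + 1)] fun _ => 0 := by
      filter_upwards [Ioi_mem_nhds (show s < s + 1 by linarith)] with v hv using hz v (le_of_lt hv)
    have h6 : χ (s + 1) = 0 :=
      ((hd1 (s + 1)).congr_of_eventuallyEq h5.symm).unique (hasDerivAt_const (s + 1) (0:ℝ))
    exact hρ (s + 1) (by linarith) (by rw [h6, hz (s + 1) (by linarith)]; ring)
  have hθX : 0 ≤ θ X := by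
    rcases hX0.eq_or_lt with hh | hh
    · rw [← hh, h.1]; exact h0
    · have := h.level hQ 0 (s := u₀) (by rw [h.1]; simpa using h0) X hh
      simp at this; exact this.le
  set m := ⌊θ X / π⌋₊ with hm
  have m1 : m * π ≤ θ X := by
    have := Nat.floor_le (div_nonneg hθX hp.le)
    rwa [le_div_iff₀ hp] at this
  have m2 : θ X < (m + 1) * π := by
    have := Nat.lt_floor_add_one (θ X / π)
    rwa [div_lt_iff₀ hp] at this
  refine ⟨m, X, fun u hu => ⟨?_, ?_⟩⟩
  · refine (hng m u hu ?_).le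
    rcases hu.eq_or_lt with rfl | hu
    · exact m1
    · exact (h.level hQ m m1 u hu).le
  · by_contra! hge
    obtain ⟨v, hv, hve⟩ := intermediate_value_Icc hu hθ.continuousOn ⟨m2.le, hge⟩
    have := hng (m + 1) v hv.1 (by push_cast; exact hve.ge)
    push_cast at this
    linarith

theorem morse_cont (k : ℝ) : Continuous (morse k) := by unfold morse; fun_prop

theorem morse_lim (k : ℝ) : Tendsto (morse k) atTop atTop := by
  have h : ∀ u, morse k u = exp u * ((1/4) * exp u + k) := by
    intro u; unfold morse; rw [two_mul, exp_add]; ring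
  rw [funext h]
  refine tendsto_exp_atTop.atTop_mul_atTop₀ ?_
  exact tendsto_atTop_add_const_right _ _ (tendsto_exp_atTop.const_mul_atTop (by norm_num))

/-- Each eigenvalue of the Morse potential on `[u₀,∞)` is a strictly increasing
function of the parameter `k`. -/
theorem stmt_7 (α u₀ k k' : ℝ) (hα0 : 0 ≤ α) (hα1 : α < 2 * Real.pi)
    (hk : k < k') (e e' : ℕ → ℝ) (he : StrictMono e) (he' : StrictMono e')
    (hre : Set.range e = evSet α u₀ (morse k))
    (hre' : Set.range e' = evSet α u₀ (morse k')) :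
    ∀ n : ℕ, e n < e' n := by
  have hp := pi_pos
  obtain ⟨θ₀, h0, h1, hα⟩ : ∃ θ₀, 0 ≤ θ₀ ∧ θ₀ < π ∧ cos α * sin θ₀ + sin α * cos θ₀ = 0 := by
    have key : ∀ j : ℕ, cos α * sin (j * π - α) + sin α * cos (j * π - α) = 0 := by
      intro j
      have := sin_nat_mul_pi j
      have h2 : sin ((j * π - α) + α) = 0 := by rw [sub_add_cancel]; exact this
      rw [sin_add] at h2
      linarith
    rcases hα0.eq_or_lt with h | h
    · exact ⟨0, le_rfl, hp, by rw [← h]; simp⟩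
    · rcases le_or_gt α π with h2 | h2
      · exact ⟨(1:ℕ) * π - α, by push_cast; linarith, by push_cast; linarith, key 1⟩
      · exact ⟨(2:ℕ) * π - α, by push_cast; linarith, by push_cast; linarith, key 2⟩
  have hex : ∀ k E, ∃ θ, Pr (fun u => E - morse k u) u₀ θ₀ θ := fun k E =>
    prf_exists (by have := morse_cont k; fun_prop) u₀ θ₀
  choose Θ hΘ using hex
  have hQ : ∀ k E, Continuous (fun u => E - morse k u) := fun k E => by
    have := morse_cont k; fun_prop
  have hQl : ∀ k E, Tendsto (fun u => E - morse k u) atTop atBot := fun k E =>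
    tendsto_atBot_add_const_left _ E (tendsto_neg_atTop_atBot.comp (morse_lim k))
  have hidx : ∀ n, ∃ m, Dec (Θ k' (e' n)) m := fun n =>
    dec_of_mem (morse_cont k') (morse_lim k') hα h0 (hΘ k' (e' n)) (hre' ▸ mem_range_self n)
  choose μ hμ using hidx
  have hdec_lt : ∀ {θ : ℝ → ℝ} {a b : ℕ} {Q : ℝ → ℝ}, Continuous Q → Pr Q u₀ θ₀ θ → Dec θ b →
      (∃ u, u₀ ≤ u ∧ ((a:ℝ) + 1) * π ≤ θ u) → a < b := by
    rintro θ a b Q hQ hP ⟨X, hX⟩ ⟨u, hu, hua⟩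
    have c1 := hP.level hQ (a + 1) (s := u) (by push_cast; exact hua) (max X (u + 1))
      (lt_of_lt_of_le (by linarith) (le_max_right _ _))
    have c2 := (hX _ (le_max_left X (u + 1))).2
    have : ((a + 1 : ℕ) : ℝ) < b + 1 := lt_of_mul_lt_mul_right (c1.trans c2) hp.le
    norm_cast at this
    omega
  have hμm : StrictMono μ := by
    apply strictMono_nat_of_lt_succ
    intro n
    have hlt := he' (Nat.lt_succ_self n)
    exact hdec_lt (hQ _ _) (hΘ k' (e' (n + 1))) (hμ (n + 1)) ((hΘ k' (e' n)).jump (hQ _ _) (hQl _ _)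
      (hΘ k' (e' (n + 1))) (fun u _ => by simpa using hlt) (hμ n))
  intro n
  have hμn : n ≤ μ n := hμm.id_le n
  obtain ⟨u₁, hu₁, hge⟩ := (hΘ k' (e' n)).jump (hQ _ _) (hQl _ _) (hΘ k (e' n)) (fun u _ => by
    have : morse k u < morse k' u := by unfold morse; nlinarith [exp_pos u]
    linarith) (hμ n)
  have hj : ∀ j : Fin (n + 1), ∃ i : ℕ, e i < e' n ∧ Dec (Θ k (e i)) j := by
    intro j
    have hjn : (j : ℕ) ≤ μ n := (Nat.lt_succ_iff.1 j.2).trans hμn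
    have hjn' : ((j : ℕ) : ℝ) ≤ μ n := by exact_mod_cast hjn
    obtain ⟨E', hE', hD⟩ := exists_dec (morse_cont k) (morse_lim k) h0 h1 (hΘ k) (m := j) hu₁
      (le_trans (mul_le_mul_of_nonneg_right (by linarith) hp.le) hge)
    have : E' ∈ range e := hre ▸ mem_of_dec (morse_cont k) (morse_lim k) hα (hΘ k E') hD
    obtain ⟨i, rfl⟩ := this
    exact ⟨i, hE', hD⟩
  choose i hi1 hi2 using hj
  have hinj : Function.Injective i := by
    intro a b hab
    have h2 := hi2 b
    rw [← hab] at h2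
    exact Fin.ext ((hi2 a).unique h2)
  have : ∃ j, n ≤ i j := by
    by_contra! hcon
    have := Fintype.card_le_of_injective (fun j => (⟨i j, hcon j⟩ : Fin n))
      (fun a b hab => hinj (by simpa using hab))
    simp at this
  obtain ⟨j, hj⟩ := this
  exact (he.monotone hj).trans_lt (hi1 j)
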